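/- arXiv:1609.00223 — 2 statements merged into one kernel-verified Lean document; each statement's English description precedes it below -/
import Mathlib

section
/- Let x ∈ Z_1(P) be a 1-cycle and let J_x : K^2(P) → Z/2 be the cochain produced by Algorithm 1. Then J_x is a cocycle, i.e. J_x ∈ Z^2(P) (equivalently δJ_x = 0). -/
/-!
Framework: the mod-2 simplicial (co)chain complex of a finite simplicial complex
triangulating a closed 3-dimensional manifold, together with its barycentric
subdivision, barycentric stars, and the algorithms of the paper.
-/

noncomputable section

open Finset

attribute [local instance] Classical.propDecidable

/-- A combinatorial encoding of a finite simplicial complex `K(P)` triangulating a closed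
3-dimensional manifold `P`: the four kinds of simplices with their incidence relations,
together with the combinatorial and topological properties of such triangulations that
are used in the paper (purity, each triangle lies in exactly two tetrahedra, strong
connectedness of vertex- and edge-stars, and homological triviality of vertex stars). -/
structure Tri3 where
  (V E T Tet : Type)
  [fV : Fintype V] [fE : Fintype E] [fT : Fintype T] [fTet : Fintype Tet]
  [dV : DecidableEq V] [dE : DecidableEq E] [dT : DecidableEq T] [dTet : DecidableEq Tet]
  vinE : V → E → Prop
  vinT : V → T → Prop
  vinTet : V → Tet → Prop
  einT : E → T → Prop
  einTet : E → Tet → Prop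
  tinTet : T → Tet → Prop
  vinT_of : ∀ {v e t}, vinE v e → einT e t → vinT v t
  vinTet_of : ∀ {v t σ}, vinT v t → tinTet t σ → vinTet v σ
  einTet_of : ∀ {e t σ}, einT e t → tinTet t σ → einTet e σ
  vinTet_of' : ∀ {v e σ}, vinE v e → einTet e σ → vinTet v σ
  edge_unique : ∀ {u v e e'}, u ≠ v → vinE u e → vinE v e → vinE u e' → vinE v e' → e = e'
  edge_card : ∀ e, Nat.card {v // vinE v e} = 2
  tri_vcard : ∀ t, Nat.card {v // vinT v t} = 3
  tri_ecard : ∀ t, Nat.card {e // einT e t} = 3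
  tet_vcard : ∀ σ, Nat.card {v // vinTet v σ} = 4
  tet_tcard : ∀ σ, Nat.card {t // tinTet t σ} = 4
  uniform_v : ∀ v, ∃ e, vinE v e
  uniform_e : ∀ e, ∃ t, einT e t
  uniform_t : ∀ t, ∃ σ, tinTet t σ
  closed_t : ∀ t, Nat.card {σ // tinTet t σ} = 2
  star_conn : ∀ v σ σ', vinTet v σ → vinTet v σ' →
    Relation.ReflTransGen (fun a b => ∃ t, vinT v t ∧ tinTet t a ∧ tinTet t b ∧ a ≠ b) σ σ'
  edgestar_conn : ∀ e σ σ', einTet e σ → einTet e σ' →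
    Relation.ReflTransGen (fun a b => ∃ t, einT e t ∧ tinTet t a ∧ tinTet t b ∧ a ≠ b) σ σ'
  star_acyclic : ∀ (v : V) (x : T → ZMod 2),
    (∀ e : E, (∑ t : T, if einT e t then x t else 0) = 0) →
    ∀ (q : ℕ) (σs : ℕ → Tet) (ts : ℕ → T), σs q = σs 0 →
      (∀ i ≤ q, vinTet v (σs i)) →
      (∀ i < q, vinT v (ts i) ∧ tinTet (ts i) (σs i) ∧ tinTet (ts i) (σs (i + 1)) ∧
        σs i ≠ σs (i + 1)) →
      (∑ i ∈ Finset.range q, x (ts i)) = 0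

attribute [instance] Tri3.fV Tri3.fE Tri3.fT Tri3.fTet Tri3.dV Tri3.dE Tri3.dT Tri3.dTet

/-- The `n`-simplices `K^n(P)` (an empty type above dimension 3). -/
def Tri3.S (P : Tri3) : ℕ → Type
  | 0 => P.V
  | 1 => P.E
  | 2 => P.T
  | 3 => P.Tet
  | _ + 4 => PEmpty

instance Tri3.instFintypeS (P : Tri3) : ∀ n, Fintype (P.S n)
  | 0 => P.fV
  | 1 => P.fE
  | 2 => P.fT
  | 3 => P.fTet
  | _ + 4 => inferInstanceAs (Fintype PEmpty)

instance Tri3.instDecEqS (P : Tri3) : ∀ n, DecidableEq (P.S n)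
  | 0 => P.dV
  | 1 => P.dE
  | 2 => P.dT
  | 3 => P.dTet
  | _ + 4 => inferInstanceAs (DecidableEq PEmpty)

/-- Mod-2 simplicial chains `C_n(P)` (identified, as usual, with cochains `C^n(P)` and with
sets of `n`-simplices). -/
abbrev Ch (P : Tri3) (n : ℕ) : Type := P.S n → ZMod 2

/-- The linear map sending a chain `c` to `b ↦ ∑ (a incident to b), c a`. -/
def incMap {A B : Type} [Fintype A] (R : B → A → Prop) :
    (A → ZMod 2) →ₗ[ZMod 2] (B → ZMod 2) where
  toFun c := fun b => ∑ a : A, if R b a then c a else 0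
  map_add' c₁ c₂ := by
    funext b
    show _ = (∑ a : A, if R b a then c₁ a else 0) + (∑ a : A, if R b a then c₂ a else 0)
    rw [← Finset.sum_add_distrib]
    exact Finset.sum_congr rfl fun a _ => by by_cases h : R b a <;> simp [h]
  map_smul' r c := by
    funext b
    show _ = r • (∑ a : A, if R b a then c a else 0)
    rw [smul_eq_mul, Finset.mul_sum]
    exact Finset.sum_congr rfl fun a _ => by by_cases h : R b a <;> simp [h]

/-- The mod-2 boundary operator `∂ : C_n(P) → C_{n-1}(P)`. -/
def Tri3.dTo (P : Tri3) : (n : ℕ) → Ch P n →ₗ[ZMod 2] Ch P (n - 1)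
  | 0 => 0
  | 1 => incMap fun v e => P.vinE v e
  | 2 => incMap fun e t => P.einT e t
  | 3 => incMap fun t σ => P.tinTet t σ
  | _ + 4 => 0

/-- The mod-2 coboundary operator `δ : C^{n-1}(P) → C^n(P)` (the transpose of `∂`). -/
def Tri3.cobTo (P : Tri3) : (n : ℕ) → Ch P (n - 1) →ₗ[ZMod 2] Ch P n
  | 0 => 0
  | 1 => incMap fun e v => P.vinE v e
  | 2 => incMap fun t e => P.einT e t
  | 3 => incMap fun σ t => P.tinTet t σ
  | _ + 4 => 0

/-- The quotient `C_n(P)/B_n(P)` of chains modulo boundaries; homology classes of cycles are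
compared inside it. -/
abbrev Hq (P : Tri3) (n : ℕ) : Type := Ch P n ⧸ LinearMap.range (P.dTo (n + 1))

/-- The class of a chain modulo boundaries. -/
def hclass (P : Tri3) (n : ℕ) (c : Ch P n) : Hq P n := Submodule.Quotient.mk c

/-- Cycles `Z_n(P)`. -/
def Zmod (P : Tri3) (n : ℕ) : Submodule (ZMod 2) (Ch P n) := LinearMap.ker (P.dTo n)

/-- Boundaries `B_n(P)`. -/
def Bmod (P : Tri3) (n : ℕ) : Submodule (ZMod 2) (Ch P n) := LinearMap.range (P.dTo (n + 1))

/-- The simplicial homology group `H_n(P)` with coefficients in `ℤ/2`. -/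
abbrev Hmod (P : Tri3) (n : ℕ) : Type :=
  (Zmod P n) ⧸ (Submodule.comap (Zmod P n).subtype (Bmod P n))

/-- The homology class `[c] ∈ H_n(P)` of a cycle `c`. -/
def zclass (P : Tri3) (n : ℕ) (c : Ch P n) (hc : c ∈ Zmod P n) : Hmod P n :=
  Submodule.Quotient.mk ⟨c, hc⟩

/-- Cocycles `Z^n(P)`. -/
def Zco (P : Tri3) (n : ℕ) : Submodule (ZMod 2) (Ch P n) := LinearMap.ker (P.cobTo (n + 1))

/-- Coboundaries `B^n(P)`. -/
def Bco (P : Tri3) (n : ℕ) : Submodule (ZMod 2) (Ch P n) := LinearMap.range (P.cobTo n)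

/-- The simplicial cohomology group `H^n(P)` with coefficients in `ℤ/2`. -/
abbrev Hcomod (P : Tri3) (n : ℕ) : Type :=
  (Zco P n) ⧸ (Submodule.comap (Zco P n).subtype (Bco P n))

/-- The cohomology class `[J] ∈ H^n(P)` of a cocycle `J`. -/
def cclass (P : Tri3) (n : ℕ) (c : Ch P n) (hc : c ∈ Zco P n) : Hcomod P n :=
  Submodule.Quotient.mk ⟨c, hc⟩

/-- Evaluation `J(y)` of a cochain `J` on a chain `y`. -/
def evalC {S : Type} [Fintype S] (J : S → ZMod 2) (c : S → ZMod 2) : ZMod 2 :=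
  ∑ s : S, c s * J s

/-- The intersection number `I(x*, y)` of the star chain `x* = ∑ g(σ)·bst(σ,P)` with the
simplicial chain `y`, i.e. `∑_{σ} g(σ)·y(σ)`. -/
def Ipair {S : Type} [Fintype S] (g : S → ZMod 2) (y : S → ZMod 2) : ZMod 2 :=
  ∑ s : S, g s * y s

/-- The chain consisting of the single simplex `s`. -/
def unitChain {S : Type} [DecidableEq S] (s : S) : S → ZMod 2 := fun t => if t = s then 1 else 0

/-- The barycentric subdivision `K'(P)` of `K(P)`: the subdivided complex `Pb`, the inclusion of
vertices, the subdivision chain maps `C_n(P) → C_n(K'(P))`, and the barycentric star chains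
`bst(σ,P) ∈ C_{3-n}(K'(P))` of the `n`-simplices `σ` of `K(P)`. -/
structure Subdiv (P : Tri3) where
  Pb : Tri3
  vmap : P.V → Pb.V
  subdiv : (n : ℕ) → Ch P n →ₗ[ZMod 2] Ch Pb n
  bst : (n : ℕ) → P.S n → Ch Pb (3 - n)

/-- The Poincaré map `F : C^l(P) → C_{3-l}(K'(P))`, `F(J) = ∑_σ J(σ)·bst(σ,P)`. -/
def Fchain {P : Tri3} (SD : Subdiv P) (l : ℕ) (J : Ch P l) : Ch SD.Pb (3 - l) :=
  fun s => ∑ σ : P.S l, J σ * SD.bst l σ s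

/-- The data produced by (and the input of) Algorithm 1 for a 1-cycle
`x = [v_0,v_1] + ⋯ + [v_{n-1},v_n]` (`v_n = v_0`, pairwise distinct edges `e i = [v_i, v_{i+1}]`):
a tetrahedron `σ i` incident to each edge `e i` (with `σ n = σ 0`), and for each `i` a
3-dimensional path `pth i 0, …, pth i (k i)` in the star of the vertex `v (i+1)` from `σ i` to
`σ (i+1)`, consecutive tetrahedra of which share the common triangle `tri i j`. -/
structure Alg1Data (P : Tri3) (x : Ch P 1) where
  n : ℕ
  npos : 0 < n
  v : ℕ → P.V
  e : ℕ → P.E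
  hcyc : v n = v 0
  einj : ∀ i < n, ∀ j < n, e i = e j → i = j
  hx : ∀ a : P.E, x a = ∑ i ∈ Finset.range n, (if e i = a then 1 else 0)
  hve : ∀ i < n, P.vinE (v i) (e i)
  hve' : ∀ i < n, P.vinE (v (i + 1)) (e i)
  hvne : ∀ i < n, v i ≠ v (i + 1)
  σ : ℕ → P.Tet
  hσcyc : σ n = σ 0
  hσ : ∀ i < n, P.einTet (e i) (σ i)
  k : ℕ → ℕ
  pth : ℕ → ℕ → P.Tet
  tri : ℕ → ℕ → P.T
  hstart : ∀ i < n, pth i 0 = σ i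
  hend : ∀ i < n, pth i (k i) = σ (i + 1)
  hstar : ∀ i < n, ∀ j ≤ k i, P.vinTet (v (i + 1)) (pth i j)
  hadj : ∀ i < n, ∀ j < k i, P.tinTet (tri i j) (pth i j) ∧ P.tinTet (tri i j) (pth i (j + 1)) ∧
    pth i j ≠ pth i (j + 1)

/-- The cochain `J_x : K^2(P) → ℤ/2` produced by Algorithm 1: `J_x(t)` is the number modulo 2
of pairs `(i,j)` with `tri i j = t`. -/
def Alg1Data.Jx {P : Tri3} {x : Ch P 1} (d : Alg1Data P x) : Ch P 2 :=
  fun t => ∑ i ∈ Finset.range d.n, ∑ j ∈ Finset.range (d.k i), (if d.tri i j = t then 1 else 0)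

/-- `v ∈ K^0(|x|)`: the vertex `v` belongs to the body of the 2-chain `x`. -/
def VinSupp (P : Tri3) (x : Ch P 2) (v : P.V) : Prop := ∃ t, x t ≠ 0 ∧ P.vinT v t

/-- `J : TP → ℤ/2` is an output of Algorithm 2 for the 2-cycle `x`: it vanishes for
`v ∉ K^0(|x|)`, and for `v ∈ K^0(|x|)` it is obtained from a starting tetrahedron `σ₀` of the
star of `v` (with `J(v,σ₀) = 0`) by propagating along 3-dimensional paths in the star of `v`,
the value jumping by `x(t)` when crossing a triangle `t`. -/
structure Alg2Output (P : Tri3) (x : Ch P 2) (J : P.V → P.Tet → ZMod 2) : Prop where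
  zero_off : ∀ v σ, ¬ VinSupp P x v → J v σ = 0
  paths : ∀ v, VinSupp P x v → ∃ σ₀, P.vinTet v σ₀ ∧ J v σ₀ = 0 ∧
    ∀ θ, P.vinTet v θ → ∃ (q : ℕ) (σs : ℕ → P.Tet) (ts : ℕ → P.T),
      σs 0 = σ₀ ∧ σs q = θ ∧ (∀ i ≤ q, P.vinTet v (σs i)) ∧
      (∀ i < q, P.vinT v (ts i) ∧ P.tinTet (ts i) (σs i) ∧ P.tinTet (ts i) (σs (i + 1)) ∧
        σs i ≠ σs (i + 1)) ∧
      (∀ i < q, J v (σs (i + 1)) = J v (σs i) + x (ts i))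

/-- `Jx : K^1(P) → ℤ/2` is the cochain produced by step 3 of Algorithm 2 from `J`:
for each edge `a = [uv]` one chooses an arbitrary incident tetrahedron `σ` and sets
`J_x(a) = J(u,σ) + J(v,σ)`. -/
def IsAlg2Jx (P : Tri3) (J : P.V → P.Tet → ZMod 2) (Jx : Ch P 1) : Prop :=
  ∀ a : P.E, ∃ u v σ, u ≠ v ∧ P.vinE u a ∧ P.vinE v a ∧ P.einTet a σ ∧
    Jx a = J u σ + J v σ

/-- The 2-chain `z₀ = ∑_{v ∈ K^0(|x|)} ∑_{σ ∈ T⁺(v)} bk'(v,σ)` of `K'(P)`. -/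
def z0chain {P : Tri3} (SD : Subdiv P) (x : Ch P 2) (J : P.V → P.Tet → ZMod 2)
    (bk' : P.V → P.Tet → Ch SD.Pb 2) : Ch SD.Pb 2 :=
  fun s => ∑ v : P.V, ∑ σ : P.Tet,
    if VinSupp P x v ∧ P.vinTet v σ ∧ J v σ = 1 then bk' v σ s else 0

/-- The 2-chain `z₁ = ∑_{v ∈ K^0(|x|)} ∑_{σ ∈ T⁺(v)} lk'(v,σ)` of `K'(P)`. -/
def z1chain {P : Tri3} (SD : Subdiv P) (x : Ch P 2) (J : P.V → P.Tet → ZMod 2)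
    (lk' : P.V → P.Tet → Ch SD.Pb 2) : Ch SD.Pb 2 :=
  fun s => ∑ v : P.V, ∑ σ : P.Tet,
    if VinSupp P x v ∧ P.vinTet v σ ∧ J v σ = 1 then lk' v σ s else 0

/-- The star 2-chain `x* = ∑_{a ∈ K^{1+}(P,x)} bst(a,P)` of `K'(P)`. -/
def xstarChain {P : Tri3} (SD : Subdiv P) (Jx : Ch P 1) : Ch SD.Pb 2 :=
  fun s => ∑ a : P.E, if Jx a = 1 then SD.bst 1 a s else 0

/-- The vertex set `V̂ = K^0(P) × (ℤ/2)^r` of the covering polyhedron `P̂`. -/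
abbrev Vhat (P : Tri3) (r : ℕ) : Type := P.V × (Fin r → ZMod 2)

/-- The simplices of `K(P)` as sets of vertices. -/
def Ksets (P : Tri3) : Set (Finset P.V) :=
  {s | (∃ v, s = {v}) ∨ (∃ e, s = Finset.univ.filter fun v => P.vinE v e) ∨
       (∃ t, s = Finset.univ.filter fun v => P.vinT v t) ∨
       (∃ σ, s = Finset.univ.filter fun v => P.vinTet v σ)}

/-- The index vector `J(c) = (J^1(c), …, J^r(c))` of a 1-chain `c`. -/
def Jvec {P : Tri3} {r : ℕ} (Jc : Fin r → Ch P 1) (c : Ch P 1) : Fin r → ZMod 2 :=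
  fun i => evalC (Jc i) c

/-- The simplicial scheme `K̂` on `V̂`: a set `ŝ` of vertices of `V̂` spans a simplex iff it
projects bijectively onto a simplex of `K(P)` and the second components satisfy
`k₂ = k₁ + J([v₁v₂])` for each edge `[v₁v₂]` of that simplex. -/
def Khat (P : Tri3) {r : ℕ} (Jc : Fin r → Ch P 1) : Set (Finset (Vhat P r)) :=
  {s | (s.image Prod.fst ∈ Ksets P) ∧ s.card = (s.image Prod.fst).card ∧
    ∀ p₁ ∈ s, ∀ p₂ ∈ s, p₁.1 ≠ p₂.1 → ∀ e : P.E, P.vinE p₁.1 e → P.vinE p₂.1 e →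
      p₂.2 = p₁.2 + Jvec Jc (unitChain e)}

/-- A deck transformation of the covering `p : P̂ → P`: a permutation of `V̂` over `K^0(P)`
preserving the simplicial scheme `K̂`. -/
def IsDeck (P : Tri3) {r : ℕ} (Jc : Fin r → Ch P 1) (g : Equiv.Perm (Vhat P r)) : Prop :=
  (∀ a, (g a).1 = a.1) ∧ ∀ s : Finset (Vhat P r), s ∈ Khat P Jc ↔ s.image g ∈ Khat P Jc

/-- A simplicial path `y = [w₀w₁] + ⋯ + [w_{q-1}w_q]` in `P`. -/
structure PathIn (P : Tri3) where
  q : ℕ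
  w : ℕ → P.V
  e : ℕ → P.E
  hve : ∀ i < q, P.vinE (w i) (e i)
  hve' : ∀ i < q, P.vinE (w (i + 1)) (e i)
  hne : ∀ i < q, w i ≠ w (i + 1)

/-- The 1-chain `[w₀w₁] + ⋯ + [w_{j-1}w_j]` of the first `j` edges of a path. -/
def PathIn.chainTo {P : Tri3} (γ : PathIn P) (j : ℕ) : Ch P 1 :=
  fun a => ∑ i ∈ Finset.range j, if γ.e i = a then 1 else 0

/-- The 1-chain of a path. -/
def PathIn.chain {P : Tri3} (γ : PathIn P) : Ch P 1 := γ.chainTo γ.q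

/-- `wh` is a lift of the path `γ` to `P̂` starting at `(γ.w 0, k₀)`: it covers `γ` and
consecutive vertices span 1-simplices of `K̂`. -/
def IsLift (P : Tri3) {r : ℕ} (Jc : Fin r → Ch P 1) (γ : PathIn P) (k0 : Fin r → ZMod 2)
    (wh : ℕ → Vhat P r) : Prop :=
  wh 0 = (γ.w 0, k0) ∧ (∀ i ≤ γ.q, (wh i).1 = γ.w i) ∧
  ∀ i < γ.q, ({wh i, wh (i + 1)} : Finset (Vhat P r)) ∈ Khat P Jc

/-- A simplicial path in the covering polyhedron `P̂`, recorded together with the edges of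
`P` that it covers. -/
structure PathHat (P : Tri3) {r : ℕ} (Jc : Fin r → Ch P 1) where
  q : ℕ
  w : ℕ → Vhat P r
  e : ℕ → P.E
  hve : ∀ i < q, P.vinE (w i).1 (e i)
  hve' : ∀ i < q, P.vinE (w (i + 1)).1 (e i)
  hne : ∀ i < q, (w i).1 ≠ (w (i + 1)).1
  hK : ∀ i < q, ({w i, w (i + 1)} : Finset (Vhat P r)) ∈ Khat P Jc

/-- The 1-chain of `P` covered by a path of `P̂` (the image chain `p(ẑ)`). -/
def PathHat.projChain {P : Tri3} {r : ℕ} {Jc : Fin r → Ch P 1} (γ : PathHat P Jc) : Ch P 1 :=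
  fun a => ∑ i ∈ Finset.range γ.q, if γ.e i = a then 1 else 0

/-- If a triangle is a common face of two distinct tetrahedra, these are its only cofaces. -/
theorem Tri3.tinTet_iff (P : Tri3) {t : P.T} {a b : P.Tet} (ha : P.tinTet t a)
    (hb : P.tinTet t b) (hab : a ≠ b) (θ : P.Tet) : P.tinTet t θ ↔ θ = a ∨ θ = b := by
  refine ⟨fun hθ => ?_, by rintro (rfl | rfl) <;> assumption⟩
  obtain ⟨p, q, -, hpq⟩ := Nat.card_eq_two_iff.1 (P.closed_t t)
  have mem (s : {σ // P.tinTet t σ}) : s = p ∨ s = q := by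
    have : s ∈ ({p, q} : Set _) := hpq ▸ Set.mem_univ s
    simpa using this
  have := mem ⟨a, ha⟩
  have := mem ⟨b, hb⟩
  have := mem ⟨θ, hθ⟩
  grind

/-- A mod-2 telescoping sum. -/
theorem ZMod.sum_range_add_succ (f : ℕ → ZMod 2) (n : ℕ) :
    ∑ i ∈ Finset.range n, (f i + f (i + 1)) = f 0 + f n := by
  simp_rw [← CharTwo.sub_eq_add (R := ZMod 2), ← neg_sub (f (_ + 1)), Finset.sum_neg_distrib,
    Finset.sum_range_sub, neg_sub]

/-- Let `x ∈ Z_1(P)` be a 1-cycle on a triangulated closed 3-dimensional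
manifold `P` and let `J_x : K^2(P) → ℤ/2` be the cochain produced by Algorithm 1.
Then `J_x` is a cocycle, i.e. `δJ_x = 0`, that is `J_x ∈ Z^2(P)`. -/
theorem stmt_0 (P : Tri3) (x : Ch P 1) (hx : P.dTo 1 x = 0) (d : Alg1Data P x) :
    P.cobTo 3 d.Jx = 0 := by
  funext (θ : P.Tet)
  let J : P.T → ZMod 2 := d.Jx
  have J_apply (t : P.T) : J t = ∑ i ∈ Finset.range d.n, ∑ j ∈ Finset.range (d.k i),
      if d.tri i j = t then 1 else 0 :=
    Finset.sum_congr rfl fun i _ => Finset.sum_congr rfl fun j _ => by congr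
  change (∑ t : P.T, if P.tinTet t θ then J t else 0) = 0
  let f : P.Tet → ZMod 2 := fun a => if a = θ then 1 else 0
  have cross (i : ℕ) (hi : i < d.n) (j : ℕ) (hj : j < d.k i) :
      (if P.tinTet (d.tri i j) θ then 1 else 0) = f (d.pth i j) + f (d.pth i (j + 1)) := by
    obtain ⟨h₁, h₂, hne⟩ := d.hadj i hi j hj
    simp only [P.tinTet_iff h₁ h₂ hne, f]
    grind
  calc (∑ t : P.T, if P.tinTet t θ then J t else 0)
      = ∑ i ∈ Finset.range d.n, ∑ j ∈ Finset.range (d.k i),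
          if P.tinTet (d.tri i j) θ then 1 else 0 := by
        simp_rw [← Finset.sum_filter (fun t => P.tinTet t θ), J_apply]
        rw [Finset.sum_comm]
        refine Finset.sum_congr rfl fun i _ => ?_
        rw [Finset.sum_comm]
        refine Finset.sum_congr rfl fun j _ => ?_
        simp [Finset.sum_ite_eq]
    _ = ∑ i ∈ Finset.range d.n, (f (d.σ i) + f (d.σ (i + 1))) := by
        refine Finset.sum_congr rfl fun i hi => ?_
        have hi := Finset.mem_range.1 hi
        rw [Finset.sum_congr rfl fun j hj => cross i hi j (Finset.mem_range.1 hj),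
          ZMod.sum_range_add_succ fun j => f (d.pth i j), d.hstart i hi, d.hend i hi]
    _ = 0 := by
        rw [ZMod.sum_range_add_succ fun i => f (d.σ i), d.hσcyc, CharTwo.add_self_eq_zero]
end
end

section
/- Let x ∈ Z_2(P) be a 2-cycle and let J_x : K^1(P) → Z/2 be the cochain produced by Algorithm 2. Then J_x is a cocycle, i.e. J_x ∈ Z^1(P) (equivalently δJ_x = 0). -/
/-!
Framework: the mod-2 simplicial (co)chain complex of a finite simplicial complex
triangulating a closed 3-dimensional manifold, together with its barycentric
subdivision, barycentric stars, and the algorithms of the paper.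
-/

noncomputable section

open Finset

attribute [local instance] Classical.propDecidable

/-- `s` is the sum of `x` over the triangles crossed by some tetrahedral path from `a` to `b`
in the star of `v`. -/
def StarPathSum (P : Tri3) (x : Ch P 2) (v : P.V) (a b : P.Tet) (s : ZMod 2) : Prop :=
  ∃ (q : ℕ) (σs : ℕ → P.Tet) (ts : ℕ → P.T), σs 0 = a ∧ σs q = b ∧
    (∀ i ≤ q, P.vinTet v (σs i)) ∧
    (∀ i < q, P.vinT v (ts i) ∧ P.tinTet (ts i) (σs i) ∧ P.tinTet (ts i) (σs (i + 1)) ∧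
      σs i ≠ σs (i + 1)) ∧
    (∑ i ∈ Finset.range q, x (ts i)) = s

theorem StarPathSum.refl {P : Tri3} (x : Ch P 2) {v : P.V} {a : P.Tet} (ha : P.vinTet v a) :
    StarPathSum P x v a a 0 :=
  ⟨0, fun _ => a, fun _ => (P.uniform_e (P.uniform_v v).choose).choose, rfl, rfl,
    fun _ _ => ha, fun i hi => absurd hi (Nat.not_lt_zero i), by simp⟩

theorem StarPathSum.snoc {P : Tri3} {x : Ch P 2} {v : P.V} {a b c : P.Tet} {s : ZMod 2}
    (h : StarPathSum P x v a b s) {t : P.T} (hv : P.vinT v t) (hb : P.tinTet t b)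
    (hc : P.tinTet t c) (hbc : b ≠ c) : StarPathSum P x v a c (s + x t) := by
  obtain ⟨q, σs, ts, h0, hq, hstar, hstep, hsum⟩ := h
  refine ⟨q + 1, Function.update σs (q + 1) c, Function.update ts q t, ?_, by simp, ?_, ?_, ?_⟩
  · rw [Function.update_of_ne (by omega), h0]
  · intro i hi
    rcases Nat.lt_or_ge q i with hqi | hqi
    · obtain rfl : i = q + 1 := by omega
      simpa using P.vinTet_of hv hc
    · rw [Function.update_of_ne (by omega)]
      exact hstar i hqi
  · intro i hi
    rcases Nat.lt_or_ge i q with hqi | hqi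
    · rw [Function.update_of_ne (by omega), Function.update_of_ne (by omega),
        Function.update_of_ne (by omega)]
      exact hstep i hqi
    · obtain rfl : i = q := by omega
      rw [Function.update_self, Function.update_self, Function.update_of_ne (by omega), hq]
      exact ⟨hv, hb, hc, hbc⟩
  · rw [Finset.sum_range_succ, Function.update_self, ← hsum]
    congr 1
    refine Finset.sum_congr rfl fun i hi => ?_
    rw [Function.update_of_ne (Finset.mem_range.1 hi).ne]

theorem StarPathSum.eq_zero_of_closed {P : Tri3} {x : Ch P 2} (hx : P.dTo 2 x = 0) {v : P.V}
    {a : P.Tet} {s : ZMod 2} (h : StarPathSum P x v a a s) : s = 0 := by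
  obtain ⟨q, σs, ts, h0, hq, hstar, hstep, rfl⟩ := h
  exact P.star_acyclic v x (fun e => congrFun hx e) q σs ts (hq.trans h0.symm) hstar hstep

/-- The output of Algorithm 2 jumps by `x t` across every triangle `t` of the star of `v`. -/
theorem Alg2Output.jump {P : Tri3} {x : Ch P 2} (hx : P.dTo 2 x = 0)
    {J : P.V → P.Tet → ZMod 2} (hJ : Alg2Output P x J) {v : P.V} {t : P.T} {a b : P.Tet}
    (hv : P.vinT v t) (ha : P.tinTet t a) (hb : P.tinTet t b) (hab : a ≠ b) :
    J v b = J v a + x t := by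
  by_cases hs : VinSupp P x v
  swap
  · have hxt : x t = 0 := by
      by_contra h
      exact hs ⟨t, h, hv⟩
    rw [hJ.zero_off v a hs, hJ.zero_off v b hs, hxt, add_zero]
  obtain ⟨σ₀, hσ₀, hJ₀, hpath⟩ := hJ.paths v hs
  have forward : StarPathSum P x v σ₀ a (J v a) := by
    obtain ⟨q, σs, ts, h0, hq, -, hstep, hval⟩ := hpath a (P.vinTet_of hv ha)
    have key : ∀ i ≤ q, StarPathSum P x v σ₀ (σs i) (J v (σs i)) := by
      intro i
      induction i with
      | zero =>
        intro _
        rw [h0, hJ₀]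
        exact .refl x hσ₀
      | succ i ih =>
        intro hi
        obtain ⟨h1, h2, h3, h4⟩ := hstep i hi
        rw [hval i hi]
        exact (ih (by omega)).snoc h1 h2 h3 h4
    exact hq ▸ key q le_rfl
  obtain ⟨q, σs, ts, h0, hq, -, hstep, hval⟩ := hpath b (P.vinTet_of hv hb)
  have backward : ∀ i ≤ q, StarPathSum P x v σ₀ (σs i) (J v a + x t + J v b + J v (σs i)) := by
    intro i hi
    induction hi using Nat.decreasingInduction with
    | self =>
      rw [hq, add_assoc, CharTwo.add_self_eq_zero, add_zero]
      exact forward.snoc hv ha hb hab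
    | of_succ i hi ih =>
      obtain ⟨h1, h2, h3, h4⟩ := hstep i hi
      convert ih.snoc h1 h3 h2 h4.symm using 1
      rw [hval i hi, ← add_assoc, CharTwo.add_cancel_right]
  have hclosed := backward 0 (Nat.zero_le q)
  rw [h0, hJ₀, add_zero] at hclosed
  exact (CharTwo.add_eq_zero.1 (hclosed.eq_zero_of_closed hx)).symm

/-- `J(u,σ) + J(v,σ)` does not depend on the tetrahedron `σ` incident to the edge `[uv]`. -/
theorem Alg2Output.add_eq_add {P : Tri3} {x : Ch P 2} (hx : P.dTo 2 x = 0)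
    {J : P.V → P.Tet → ZMod 2} (hJ : Alg2Output P x J) {u v : P.V} {e : P.E} {σ σ' : P.Tet}
    (hu : P.vinE u e) (hv : P.vinE v e) (hσ : P.einTet e σ) (hσ' : P.einTet e σ') :
    J u σ + J v σ = J u σ' + J v σ' := by
  induction P.edgestar_conn e σ σ' hσ hσ' with
  | refl => rfl
  | tail _ hstep ih =>
    obtain ⟨t, het, ha, hb, hab⟩ := hstep
    rw [ih (P.einTet_of het ha), hJ.jump hx (P.vinT_of hu het) ha hb hab,
      hJ.jump hx (P.vinT_of hv het) ha hb hab, add_add_add_comm, CharTwo.add_self_eq_zero,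
      add_zero]

/-- The vertex set of an edge. -/
def Tri3.edgeVerts (P : Tri3) (e : P.E) : Finset P.V := Finset.univ.filter fun v => P.vinE v e

theorem Tri3.card_edgeVerts (P : Tri3) (e : P.E) : (P.edgeVerts e).card = 2 := by
  rw [← P.edge_card e, Nat.card_eq_fintype_card, Fintype.card_subtype]
  rfl

theorem Tri3.edgeVerts_injective (P : Tri3) : Function.Injective P.edgeVerts := by
  intro e e' h
  obtain ⟨u, v, huv, he⟩ := Finset.card_eq_two.1 (P.card_edgeVerts e)
  have mem : ∀ w, w ∈ P.edgeVerts e → P.vinE w e ∧ P.vinE w e' := fun w hw =>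
    ⟨(Finset.mem_filter.1 hw).2, (Finset.mem_filter.1 (h.subset hw)).2⟩
  have hu := mem u (by simp [he])
  have hv := mem v (by simp [he])
  exact P.edge_unique huv hu.1 hv.1 hu.2 hv.2

/-- The edges of a triangle correspond to the pairs of its vertices. -/
theorem Tri3.image_edgeVerts (P : Tri3) (t : P.T) :
    (Finset.univ.filter fun e => P.einT e t).image P.edgeVerts =
      (Finset.univ.filter fun v => P.vinT v t).powersetCard 2 := by
  refine Finset.eq_of_subset_of_card_le ?_ ?_
  · intro s hs
    obtain ⟨e, he, rfl⟩ := Finset.mem_image.1 hs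
    refine Finset.mem_powersetCard.2 ⟨fun v hv => ?_, P.card_edgeVerts e⟩
    exact Finset.mem_filter.2 ⟨Finset.mem_univ v,
      P.vinT_of (Finset.mem_filter.1 hv).2 (Finset.mem_filter.1 he).2⟩
  · have hV := P.tri_vcard t
    have hE := P.tri_ecard t
    rw [Nat.card_eq_fintype_card, Fintype.card_subtype] at hV hE
    rw [Finset.card_powersetCard, Finset.card_image_of_injective _ P.edgeVerts_injective, hV, hE]
    decide

/-- A coboundary of a vertex function vanishes on the boundary of a triangle. -/
theorem Tri3.sum_edges_sum_verts (P : Tri3) (t : P.T) (f : P.V → ZMod 2) :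
    ∑ e ∈ Finset.univ.filter (fun e => P.einT e t), ∑ v ∈ P.edgeVerts e, f v = 0 := by
  rw [← Finset.sum_image (f := fun s => ∑ v ∈ s, f v) P.edgeVerts_injective.injOn,
    P.image_edgeVerts]
  have hV := P.tri_vcard t
  rw [Nat.card_eq_fintype_card, Fintype.card_subtype] at hV
  obtain ⟨u, v, w, huv, huw, hvw, h⟩ := Finset.card_eq_three.1 hV
  have hne : ({u, w} : Finset P.V) ≠ {v, w} := fun h => by
    have : u ∈ ({v, w} : Finset P.V) := h ▸ Finset.mem_insert_self u {w}
    simp [huv, huw] at this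
  have hnotMem : ({u, v} : Finset P.V) ∉ ({{u, w}, {v, w}} : Finset (Finset P.V)) := fun h => by
    rcases Finset.mem_insert.1 h with h | h
    · have : v ∈ ({u, w} : Finset P.V) := h ▸ by simp
      simp [huv.symm, hvw] at this
    · have : u ∈ ({v, w} : Finset P.V) := Finset.mem_singleton.1 h ▸ Finset.mem_insert_self u {v}
      simp [huv, huw] at this
  have hpairs : ({u, v, w} : Finset P.V).powersetCard 2 = {{u, v}, {u, w}, {v, w}} := by
    refine (Finset.eq_of_subset_of_card_le ?_ ?_).symm
    · simp [Finset.insert_subset_iff, Finset.mem_powersetCard, huv, huw, hvw]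
    · rw [Finset.card_powersetCard, ← h, hV, Finset.card_insert_of_notMem hnotMem,
        Finset.card_pair hne]
      decide
  rw [h, hpairs, Finset.sum_insert hnotMem, Finset.sum_pair hne, Finset.sum_pair huv,
    Finset.sum_pair huw, Finset.sum_pair hvw]
  grind

/-- Let `x ∈ Z_2(P)` be a 2-cycle on a triangulated closed 3-dimensional
manifold `P`, let `J` be the function on vertex–tetrahedron pairs produced by Algorithm 2 and
`J_x : K^1(P) → ℤ/2` the resulting cochain.  Then `J_x` is a cocycle, i.e. `δJ_x = 0`,
that is `J_x ∈ Z^1(P)`. -/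
theorem stmt_3 (P : Tri3) (x : Ch P 2) (hx : P.dTo 2 x = 0)
    (J : P.V → P.Tet → ZMod 2) (hJ : Alg2Output P x J)
    (Jx : Ch P 1) (hJx : IsAlg2Jx P J Jx) :
    P.cobTo 2 Jx = 0 := by
  funext t
  obtain ⟨σ, hσ⟩ := P.uniform_t t
  suffices h : ∑ e ∈ Finset.univ.filter (fun e => P.einT e t), Jx e = 0 from
    (Finset.sum_filter _ _).symm.trans h
  refine (Finset.sum_congr rfl fun e he => ?_).trans (P.sum_edges_sum_verts t fun v => J v σ)
  obtain ⟨u, v, τ, huv, hu, hv, hτ, h⟩ := hJx e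
  have hverts : P.edgeVerts e = {u, v} := by
    refine (Finset.eq_of_subset_of_card_le ?_ ?_).symm
    · simp [Finset.insert_subset_iff, Tri3.edgeVerts, hu, hv]
    · rw [P.card_edgeVerts, Finset.card_pair huv]
  rw [hverts, Finset.sum_pair huv, h]
  exact hJ.add_eq_add hx hu hv hτ (P.einTet_of (Finset.mem_filter.1 he).2 hσ)
end
end
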